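/- Let T be a linear map on a C*-algebra A that is triple derivable at orthogonal pairs. Then {a, T(b), c} = 0 for all a, b, c ∈ A with a ⊥ b and c ⊥ b. -/

import Mathlib

variable {A : Type*} [NonUnitalNormedRing A] [StarRing A] [CStarRing A]
  [NormedSpace ℂ A] [IsScalarTower ℂ A A] [SMulCommClass ℂ A A]
  [StarModule ℂ A] [CompleteSpace A]

/-- The triple product `{x,y,z} = (1/2)(x y* z + z y* x)` on a C*-algebra. -/
noncomputable def tp (x y z : A) : A := (2⁻¹ : ℂ) • (x * star y * z + z * star y * x)

/-- Orthogonality: `a ⊥ b` iff `a b* = 0` and `b* a = 0`. -/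
def Orthog (a b : A) : Prop := a * star b = 0 ∧ star b * a = 0

/-- A map is triple derivable at orthogonal pairs. -/
def TripleDerivableAtOrthPairs (T : A → A) : Prop :=
  ∀ a b c : A, Orthog a b →
    tp (T a) b c + tp a (T b) c + tp a b (T c) = 0

/-- if `T` is triple derivable at orthogonal pairs then
`{a, T b, c} = 0` whenever `a ⊥ b` and `c ⊥ b`. -/
theorem stmt8 (T : A →ₗ[ℂ] A)
    (hT : TripleDerivableAtOrthPairs (T : A → A)) :
    ∀ a b c : A, Orthog a b → Orthog c b → tp a (T b) c = 0 := by
  rintro a b c hab ⟨hcb, hbc⟩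
  have h := hT a b c hab
  obtain ⟨hab, hba⟩ := hab
  have h₁ : tp (T a) b c = 0 := by simp [tp, mul_assoc (T a), hcb, hbc]
  have h₂ : tp a b (T c) = 0 := by simp [tp, mul_assoc (T c), hab, hba]
  simpa [h₁, h₂] using h
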